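/- Let a, μ ∈ ℝ and b, σ > 0, and let X be a random variable with law N(a, b²). Then E[((X − μ)/σ)·(1 − Φ((X − μ)/σ))] = ((a − μ)/σ)·(1 − Φ((a − μ)/√(σ² + b²))) − (b²/σ²)·E[φ((X − μ)/σ)], where φ and Φ denote the standard normal probability density function and cumulative distribution function. -/

import Mathlib

open MeasureTheory ProbabilityTheory Real

/-- The probability density function of the standard normal distribution. -/
noncomputable def stdNormalPDF (z : ℝ) : ℝ := (Real.sqrt (2 * π))⁻¹ * Real.exp (-z ^ 2 / 2)

/-- The cumulative distribution function of the standard normal distribution. -/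
noncomputable def stdNormalCDF (z : ℝ) : ℝ := ∫ t in Set.Iic z, stdNormalPDF t

open scoped NNReal

lemma stdNormalPDF_eq_gaussianPDFReal : stdNormalPDF = gaussianPDFReal 0 1 := by
  ext z
  simp [stdNormalPDF, gaussianPDFReal]

lemma continuous_stdNormalPDF : Continuous stdNormalPDF := by
  unfold stdNormalPDF
  fun_prop

lemma integrable_stdNormalPDF : Integrable stdNormalPDF := by
  rw [stdNormalPDF_eq_gaussianPDFReal]
  exact integrable_gaussianPDFReal 0 1

lemma stdNormalCDF_eq_measureReal (z : ℝ) :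
    stdNormalCDF z = (gaussianReal 0 1).real (Set.Iic z) := by
  rw [measureReal_def, gaussianReal_apply_eq_integral 0 one_ne_zero, ENNReal.toReal_ofReal,
    stdNormalCDF, stdNormalPDF_eq_gaussianPDFReal]
  exact integral_nonneg fun x ↦ gaussianPDFReal_nonneg 0 1 x

lemma stdNormalCDF_mem_Icc (z : ℝ) : stdNormalCDF z ∈ Set.Icc 0 1 := by
  rw [stdNormalCDF_eq_measureReal]
  exact ⟨measureReal_nonneg, measureReal_le_one⟩

lemma norm_one_sub_stdNormalCDF_le_one (z : ℝ) : ‖1 - stdNormalCDF z‖ ≤ 1 := by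
  obtain ⟨h0, h1⟩ := stdNormalCDF_mem_Icc z
  rw [Real.norm_eq_abs, abs_le]
  constructor <;> linarith

lemma hasDerivAt_stdNormalCDF (z : ℝ) : HasDerivAt stdNormalCDF (stdNormalPDF z) z := by
  have h : stdNormalCDF = fun x ↦ (∫ t in (0 : ℝ)..x, stdNormalPDF t) + stdNormalCDF 0 := by
    ext x
    rw [← intervalIntegral.integral_Iic_sub_Iic integrable_stdNormalPDF.integrableOn
      integrable_stdNormalPDF.integrableOn]
    simp [stdNormalCDF]
  rw [h]
  exact (intervalIntegral.integral_hasDerivAt_right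
    (continuous_stdNormalPDF.intervalIntegrable _ _)
    (continuous_stdNormalPDF.stronglyMeasurableAtFilter _ _)
    continuous_stdNormalPDF.continuousAt).add_const _

lemma continuous_stdNormalCDF : Continuous stdNormalCDF :=
  continuous_iff_continuousAt.2 fun z ↦ (hasDerivAt_stdNormalCDF z).continuousAt

lemma stdNormalPDF_le_one (z : ℝ) : ‖stdNormalPDF z‖ ≤ 1 := by
  have h1 : 1 ≤ √(2 * π) := Real.one_le_sqrt.2 (by linarith [Real.two_le_pi])
  have h2 : rexp (-z ^ 2 / 2) ≤ 1 := Real.exp_le_one_iff.2 (by nlinarith [sq_nonneg z])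
  rw [Real.norm_eq_abs, stdNormalPDF, abs_of_nonneg (by positivity)]
  exact mul_le_one₀ (inv_le_one_of_one_le₀ h1) (Real.exp_pos _).le h2

lemma integrable_gaussianReal_iff {m : ℝ} {v : ℝ≥0} (hv : v ≠ 0) {f : ℝ → ℝ} :
    Integrable f (gaussianReal m v) ↔ Integrable fun x ↦ gaussianPDFReal m v x * f x := by
  rw [gaussianReal_of_var_ne_zero m hv, integrable_withDensity_iff_integrable_smul'
    (measurable_gaussianPDF m v) (ae_of_all _ fun _ ↦ gaussianPDF_lt_top)]
  simp only [toReal_gaussianPDF, smul_eq_mul]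

lemma hasDerivAt_gaussianPDFReal (m : ℝ) {v : ℝ≥0} (hv : v ≠ 0) (x : ℝ) :
    HasDerivAt (gaussianPDFReal m v) (-((x - m) / v) * gaussianPDFReal m v x) x := by
  have hv' : (v : ℝ) ≠ 0 := by exact_mod_cast hv
  have h : HasDerivAt (fun y ↦ -(y - m) ^ 2 / (2 * (v : ℝ))) (-((x - m) / v)) x := by
    convert! ((((hasDerivAt_id x).sub_const m).pow 2).neg.div_const (2 * (v : ℝ))) using 1
    simp
    field_simp
  convert! (h.exp.const_mul (√(2 * π * v))⁻¹) using 1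
  simp only [gaussianPDFReal]
  ring

/-- **Stein's lemma** for a real Gaussian distribution. -/
lemma integral_sub_mul_gaussianReal {m : ℝ} {v : ℝ≥0} (hv : v ≠ 0) {h h' : ℝ → ℝ}
    (hh : ∀ x, HasDerivAt h (h' x) x) (hi : Integrable h (gaussianReal m v))
    (hi' : Integrable h' (gaussianReal m v))
    (hxi : Integrable (fun x ↦ (x - m) * h x) (gaussianReal m v)) :
    ∫ x, (x - m) * h x ∂gaussianReal m v = v * ∫ x, h' x ∂gaussianReal m v := by
  have hv' : (v : ℝ) ≠ 0 := by exact_mod_cast hv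
  rw [integrable_gaussianReal_iff hv] at hi hi' hxi
  have key := integral_mul_deriv_eq_deriv_mul_of_integrable (u := h) (u' := h')
    (v := gaussianPDFReal m v) (v' := fun x ↦ -((x - m) / v) * gaussianPDFReal m v x)
    (fun x _ ↦ hh x) (fun x _ ↦ hasDerivAt_gaussianPDFReal m hv x)
    ((hxi.const_mul (-(v : ℝ)⁻¹)).congr (ae_of_all _ fun x ↦ by simp; ring))
    (hi'.congr (ae_of_all _ fun x ↦ by simp [mul_comm]))
    (hi.congr (ae_of_all _ fun x ↦ by simp [mul_comm]))
  have hl : ∫ x, h x * (-((x - m) / v) * gaussianPDFReal m v x)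
      = -(v : ℝ)⁻¹ * ∫ x, gaussianPDFReal m v x * ((x - m) * h x) := by
    rw [← integral_const_mul]
    congr with x
    ring
  rw [integral_gaussianReal_eq_integral_smul hv, integral_gaussianReal_eq_integral_smul hv]
  simp only [smul_eq_mul]
  simp only [hl, mul_comm (h' _)] at key
  rw [neg_mul, neg_inj, inv_mul_eq_iff_eq_mul₀ hv'] at key
  exact key

lemma integral_stdNormalCDF_gaussianReal (m : ℝ) (v : ℝ≥0) :
    ∫ x, stdNormalCDF x ∂gaussianReal m v = stdNormalCDF (m / √(1 + v)) := by
  have hs : 0 < √(1 + (v : ℝ)) := by positivity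
  have hmap : gaussianReal (-m) (v + 1)
      = (gaussianReal 0 1).map fun x ↦ √(1 + (v : ℝ)) * x + -m := by
    change _ = (gaussianReal 0 1).map ((· + -m) ∘ (√(1 + (v : ℝ)) * ·))
    rw [← Measure.map_map (by fun_prop) (by fun_prop),
      gaussianReal_map_const_mul, gaussianReal_map_add_const]
    congr 1
    · simp
    · ext
      simp [Real.sq_sqrt (by positivity : 0 ≤ (v : ℝ) + 1), add_comm]
  have hright : gaussianReal (-m) (v + 1) (Set.Iic 0)
      = gaussianReal 0 1 (Set.Iic (m / √(1 + (v : ℝ)))) := by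
    rw [hmap, Measure.map_apply (by fun_prop) measurableSet_Iic]
    congr 1
    ext x
    simp [le_div_iff₀ hs, mul_comm]
  have hleft : gaussianReal (-m) (v + 1) (Set.Iic 0)
      = ∫⁻ x, gaussianReal 0 1 (Set.Iic x) ∂gaussianReal m v := by
    have hmeas : Measurable fun x : ℝ ↦ gaussianReal 0 1 (Set.Iic (-x)) :=
      Antitone.measurable fun x y hxy ↦ measure_mono (Set.Iic_subset_Iic.2 (neg_le_neg hxy))
    rw [← add_zero (-m), ← gaussianReal_conv_gaussianReal,
      ← lintegral_indicator_one measurableSet_Iic,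
      Measure.lintegral_conv (measurable_one.indicator measurableSet_Iic),
      ← neg_neg m, ← gaussianReal_map_neg (μ := -m), neg_neg,
      lintegral_map (by simpa [Function.comp_def] using hmeas.comp measurable_neg) measurable_neg]
    congr with x
    rw [← lintegral_indicator_one measurableSet_Iic]
    congr with y
    simp [Set.indicator, ← le_neg_iff_add_nonpos_left]
  simp only [stdNormalCDF_eq_measureReal, measureReal_def]
  rw [integral_toReal, ← hleft, hright]
  · exact (Monotone.measurable fun x y hxy ↦
      measure_mono (Set.Iic_subset_Iic.2 hxy)).aemeasurable
  · exact ae_of_all _ fun _ ↦ measure_lt_top _ _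

lemma integral_mul_one_sub_stdNormalCDF_gaussianReal (m : ℝ) {v : ℝ≥0} (hv : v ≠ 0) :
    ∫ x, x * (1 - stdNormalCDF x) ∂gaussianReal m v
      = m * (1 - stdNormalCDF (m / √(1 + v))) - v * ∫ x, stdNormalPDF x ∂gaussianReal m v := by
  have hcont : Continuous fun x ↦ 1 - stdNormalCDF x := continuous_const.sub continuous_stdNormalCDF
  have hΦ : Integrable stdNormalCDF (gaussianReal m v) :=
    .of_bound continuous_stdNormalCDF.aestronglyMeasurable 1 (ae_of_all _ fun x ↦ by
      rw [Real.norm_eq_abs, abs_of_nonneg (stdNormalCDF_mem_Icc x).1]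
      exact (stdNormalCDF_mem_Icc x).2)
  have hφ : Integrable stdNormalPDF (gaussianReal m v) :=
    .of_bound continuous_stdNormalPDF.aestronglyMeasurable 1 (ae_of_all _ stdNormalPDF_le_one)
  have hh : Integrable (fun x ↦ 1 - stdNormalCDF x) (gaussianReal m v) :=
    (integrable_const 1).sub hΦ
  have hid : Integrable (fun x ↦ x) (gaussianReal m v) :=
    memLp_one_iff_integrable.1 (memLp_id_gaussianReal 1)
  have hxi : Integrable (fun x ↦ (x - m) * (1 - stdNormalCDF x)) (gaussianReal m v) :=
    (hid.sub (integrable_const m)).mul_bdd (c := 1) hcont.aestronglyMeasurable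
      (ae_of_all _ norm_one_sub_stdNormalCDF_le_one)
  have stein := integral_sub_mul_gaussianReal hv
    (fun x ↦ (hasDerivAt_stdNormalCDF x).const_sub 1) hh hφ.neg hxi
  have hsplit : ∫ x, x * (1 - stdNormalCDF x) ∂gaussianReal m v
      = ∫ x, (x - m) * (1 - stdNormalCDF x) ∂gaussianReal m v
        + m * ∫ x, (1 - stdNormalCDF x) ∂gaussianReal m v := by
    rw [← integral_const_mul, ← integral_add hxi (hh.const_mul m)]
    congr with x
    ring
  rw [hsplit, stein, integral_neg, integral_sub (integrable_const 1) hΦ,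
    integral_stdNormalCDF_gaussianReal]
  simp
  ring

/-- Stein's-lemma identity: for `X ~ N(a, b²)`,
`E[((X − μ)/σ)·(1 − Φ((X − μ)/σ))]
  = ((a − μ)/σ)·(1 − Φ((a − μ)/√(σ² + b²))) − (b²/σ²)·E[φ((X − μ)/σ)]`. -/
theorem stmt12 {Ω : Type*} [MeasurableSpace Ω] (P : Measure Ω) [IsProbabilityMeasure P]
    (X : Ω → ℝ) (a μ b σ : ℝ) (hb : 0 < b) (hσ : 0 < σ)
    (hX : P.map X = gaussianReal a ⟨b ^ 2, sq_nonneg b⟩) :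
    ∫ ω, ((X ω - μ) / σ) * (1 - stdNormalCDF ((X ω - μ) / σ)) ∂P
      = ((a - μ) / σ) * (1 - stdNormalCDF ((a - μ) / Real.sqrt (σ ^ 2 + b ^ 2)))
        - (b ^ 2 / σ ^ 2) * ∫ ω, stdNormalPDF ((X ω - μ) / σ) ∂P := by
  change P.map X = gaussianReal a (.mk (b ^ 2) (sq_nonneg b)) at hX
  have hXm : AEMeasurable X P := aemeasurable_of_map_neZero (by rw [hX]; infer_instance)
  let v : ℝ≥0 := .mk (b ^ 2) (sq_nonneg b) / .mk (σ ^ 2) (sq_nonneg σ)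
  have hv : (v : ℝ) = b ^ 2 / σ ^ 2 := rfl
  have hv0 : v ≠ 0 := by
    rw [← NNReal.coe_ne_zero, hv]
    positivity
  have hlaw : P.map (fun ω ↦ (X ω - μ) / σ) = gaussianReal ((a - μ) / σ) v := by
    have hcomp : (fun ω ↦ (X ω - μ) / σ) = (· / σ) ∘ (· - μ) ∘ X := rfl
    rw [hcomp, ← AEMeasurable.map_map_of_aemeasurable (by fun_prop) (by fun_prop),
      ← AEMeasurable.map_map_of_aemeasurable (by fun_prop) hXm, hX,
      gaussianReal_map_sub_const, gaussianReal_map_div_const]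
  have hUm : AEMeasurable (fun ω ↦ (X ω - μ) / σ) P := by fun_prop
  have htransfer (f : ℝ → ℝ) (hf : Continuous f) :
      ∫ ω, f ((X ω - μ) / σ) ∂P = ∫ x, f x ∂gaussianReal ((a - μ) / σ) v := by
    rw [← hlaw, integral_map hUm hf.aestronglyMeasurable]
  have hsqrt : (a - μ) / √(σ ^ 2 + b ^ 2) = (a - μ) / σ / √(1 + v) := by
    rw [hv, div_div, ← Real.sqrt_sq hσ.le, ← Real.sqrt_mul (sq_nonneg _), Real.sqrt_sq hσ.le]
    congr 2
    field_simp
  rw [htransfer (fun x ↦ x * (1 - stdNormalCDF x))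
      (continuous_id.mul (continuous_const.sub continuous_stdNormalCDF)),
    htransfer stdNormalPDF continuous_stdNormalPDF, hsqrt, ← hv]
  exact integral_mul_one_sub_stdNormalCDF_gaussianReal _ hv0
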